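/- Let f ∈ C(𝕋, B(H)) and let A_f = (T_{kj}) be the Toeplitz matrix with T_{kj} = f̂(j−k). Then A_f defines a bounded operator on ℓ²(H) belonging to 𝒞(ℓ²(H)), and ‖A_f‖_{B(ℓ²(H))} = ‖f‖_{C(𝕋, B(H))} = sup_t ‖f(t)‖_{B(H)}. -/

import Mathlib

noncomputable section

/-- The Hilbert space `ℓ²(H)` of square-summable `H`-valued sequences. -/
abbrev ellTwo (H : Type) [NormedAddCommGroup H] [InnerProductSpace ℂ H] : Type :=
  lp (fun _ : ℕ => H) 2

variable {H : Type} [NormedAddCommGroup H] [InnerProductSpace ℂ H] [CompleteSpace H]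
  [TopologicalSpace.SeparableSpace H]

/-- A bounded operator `A` on `ℓ²(H)` is represented by the matrix `T = (T_{kj})`
(with `T k j ∈ B(H)`) if `(A (x e_j))_k = T_{kj} x` for all `j, k, x`. -/
def Represents (T : ℕ → ℕ → (H →L[ℂ] H))
    (A : ellTwo H →L[ℂ] ellTwo H) : Prop :=
  ∀ (j : ℕ) (x : H) (k : ℕ), A (lp.single 2 j x) k = T k j x

/-- A "polynomial" matrix: finitely many nonzero diagonals and uniformly bounded entries. -/
def PolyMat (T : ℕ → ℕ → (H →L[ℂ] H)) : Prop :=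
  (∃ N : ℕ, ∀ k j : ℕ, (N : ℤ) < |(j : ℤ) - (k : ℤ)| → T k j = 0) ∧
  (∃ M : ℝ, ∀ k j : ℕ, ‖T k j‖ ≤ M)

/-- The class `𝒞(ℓ²(H))`: the closure in `B(ℓ²(H))` of the operators represented by
polynomial matrices. -/
def ContinuousClass (A : ellTwo H →L[ℂ] ellTwo H) : Prop :=
  A ∈ closure {B : ellTwo H →L[ℂ] ellTwo H | ∃ T, PolyMat T ∧ Represents T B}

/-- The `l`-th Fourier coefficient of a (`2π`-periodic) `B(H)`-valued function. -/
def opFourierCoeff (f : ℝ → (H →L[ℂ] H)) (l : ℤ) : H →L[ℂ] H :=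
  (1 / (2 * Real.pi) : ℝ) •
    ∫ t in (0 : ℝ)..(2 * Real.pi), Complex.exp (-Complex.I * l * t) • f t

open MeasureTheory AddCircle

instance toepFact : Fact (0 < 2 * Real.pi) := ⟨Real.two_pi_pos⟩

/-- The circle. -/
abbrev Circ : Type := AddCircle (2 * Real.pi)

/-- normalized Haar measure -/
abbrev haarC : Measure Circ := haarAddCircle

lemma haarC_openPos : (haarC).IsOpenPosMeasure := by
  have : (haarC).IsAddHaarMeasure := inferInstanceAs (Measure.IsAddHaarMeasure
    (Measure.addHaarMeasure ⊤))
  infer_instance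

/-- `φ ↦ (t ↦ φ t • T)` -/
def tens {E : Type} [NormedAddCommGroup E] [NormedSpace ℂ E] (T : E) :
    C(Circ, ℂ) →L[ℂ] C(Circ, E) :=
  ((ContinuousLinearMap.id ℂ ℂ).smulRight T).compLeftContinuous ℂ Circ

@[simp] lemma tens_apply {E : Type} [NormedAddCommGroup E] [NormedSpace ℂ E] (T : E)
    (φ : C(Circ, ℂ)) (t : Circ) : tens T φ t = φ t • T := rfl

/-- embedding into L2 -/
def toL2 : C(Circ, H) →L[ℂ] Lp H 2 haarC := ContinuousMap.toLp 2 haarC ℂ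

/-- multiplication operator -/
def mulOp : C(Circ, H →L[ℂ] H) →L[ℂ] (Lp H 2 haarC →L[ℂ] Lp H 2 haarC) :=
  ((ContinuousLinearMap.id ℂ (H →L[ℂ] H)).holderL haarC ⊤ 2 2) ∘L
    (ContinuousMap.toLp ⊤ haarC ℂ)

lemma inner_toL2 (F G : C(Circ, H)) :
    inner ℂ (toL2 F) (toL2 G) = ∫ t, inner ℂ (F t) (G t) ∂haarC := by
  rw [L2.inner_def]
  apply integral_congr_ae
  filter_upwards [ContinuousMap.coeFn_toLp (𝕜 := ℂ) (p := 2) haarC F,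
    ContinuousMap.coeFn_toLp (𝕜 := ℂ) (p := 2) haarC G] with t h1 h2
  simp only [toL2, h1, h2]

lemma inner_mulOp (f : C(Circ, H →L[ℂ] H)) (F G : C(Circ, H)) :
    inner ℂ (toL2 F) (mulOp f (toL2 G)) = ∫ t, inner ℂ (F t) (f t (G t)) ∂haarC := by
  rw [L2.inner_def]
  apply integral_congr_ae
  filter_upwards [ContinuousMap.coeFn_toLp (𝕜 := ℂ) (p := 2) haarC F,
    ContinuousMap.coeFn_toLp (𝕜 := ℂ) (p := 2) haarC G,
    ContinuousMap.coeFn_toLp (𝕜 := ℂ) (p := ⊤) haarC f,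
    (ContinuousLinearMap.id ℂ (H →L[ℂ] H)).coeFn_holder (r := 2)
      (ContinuousMap.toLp ⊤ haarC ℂ f) (toL2 G)] with t h1 h2 h3 h4
  have h5 : (mulOp f (toL2 G)) t = f t (G t) := by
    change (((ContinuousLinearMap.id ℂ (H →L[ℂ] H)).holder 2
      (ContinuousMap.toLp ⊤ haarC ℂ f) (toL2 G) : Lp H 2 haarC)) t = _
    rw [h4, h3, toL2, h2]; rfl
  rw [h5, toL2, h1]

lemma norm_mulOp_le (f : C(Circ, H →L[ℂ] H)) : ‖mulOp f‖ ≤ ‖f‖ := by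
  have h1 : ‖(ContinuousMap.toLp ⊤ haarC ℂ f : Lp (H →L[ℂ] H) ⊤ haarC)‖ ≤ ‖f‖ := by
    refine (ContinuousLinearMap.le_of_opNorm_le _ (ContinuousMap.toLp_norm_le haarC) f).trans ?_
    simp
  refine ((ContinuousLinearMap.holderL haarC ⊤ 2 2
    (ContinuousLinearMap.id ℂ (H →L[ℂ] H))).le_of_opNorm_le
      ((ContinuousLinearMap.norm_holderL_le _).trans ContinuousLinearMap.norm_id_le) _).trans ?_
  rwa [one_mul]

lemma norm_toL2_tens_sq (φ : C(Circ, ℂ)) (x : H) :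
    ‖toL2 (tens x φ)‖ ^ 2 = (∫ t, ‖φ t‖ ^ 2 ∂haarC) * ‖x‖ ^ 2 := by
  have h := inner_toL2 (tens x φ) (tens x φ)
  rw [inner_self_eq_norm_sq_to_K] at h
  simp only [inner_self_eq_norm_sq_to_K, tens_apply, norm_smul] at h
  have h2 : ∫ t, ((((‖φ t‖ * ‖x‖ : ℝ) : ℂ)) ^ 2) ∂haarC =
      ((∫ t, (‖φ t‖ * ‖x‖) ^ 2 ∂haarC : ℝ) : ℂ) := by
    rw [← integral_complex_ofReal]; simp
  have h3 : ((‖toL2 (tens x φ)‖ ^ 2 : ℝ) : ℂ) = ((∫ t, (‖φ t‖ * ‖x‖) ^ 2 ∂haarC : ℝ) : ℂ) := by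
    rw [← h2, Complex.ofReal_pow]; exact h
  rw [Complex.ofReal_inj.1 h3, ← integral_mul_const]
  simp only [mul_pow]

lemma inner_tens (f : C(Circ, H →L[ℂ] H)) (φ : C(Circ, ℂ)) (x y : H) :
    inner ℂ (toL2 (tens y φ)) (mulOp f (toL2 (tens x φ))) =
      ∫ t, ((‖φ t‖ ^ 2 : ℝ) : ℂ) * inner ℂ y (f t x) ∂haarC := by
  rw [inner_mulOp]
  congr 1; ext t
  simp only [tens_apply, map_smul, inner_smul_left, inner_smul_right]
  rw [← mul_assoc, Complex.mul_conj']; norm_cast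

/-- the isometric embeddings of `H` -/
def Vemb (j : ℕ) : H →ₗᵢ[ℂ] Lp H 2 haarC where
  toFun x := toL2 (tens x (fourier (-(j : ℤ))))
  map_add' x y := by
    rw [← map_add]; congr 1; ext t; simp
  map_smul' c x := by
    change _ = c • toL2 (tens x (fourier (-(j : ℤ))))
    rw [← map_smul]; congr 1; ext t; exact smul_comm _ _ _
  norm_map' x := by
    have h := norm_toL2_tens_sq (fourier (-(j : ℤ))) x
    have h1 : ∀ t : Circ, ‖fourier (-(j : ℤ)) t‖ = 1 := fun t => Circle.norm_coe _
    simp only [h1] at h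
    simp at h
    exact h

lemma Vemb_apply (j : ℕ) (x : H) : Vemb j x = toL2 (tens x (fourier (-(j : ℤ)))) := rfl

lemma Vorth : OrthogonalFamily ℂ (fun _ : ℕ => H) (Vemb (H := H)) := by
  intro i j hij x y
  rw [Vemb_apply, Vemb_apply, inner_toL2]
  have h := orthonormal_fourier (T := 2 * Real.pi)
  have h2 := h.2 (show (-(i : ℤ)) ≠ -(j : ℤ) by omega)
  have h2 : ∫ t, fourier (-(j : ℤ)) t * (starRingEnd ℂ) (fourier (-(i : ℤ)) t) ∂haarC = 0 := by
    rw [← h2]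
    exact (ContinuousMap.inner_toLp haarC (fourier (-(i : ℤ))) (fourier (-(j : ℤ)))).symm
  simp only [tens_apply, inner_smul_left, inner_smul_right]
  calc _ = ∫ t, (fourier (-(j : ℤ)) t * (starRingEnd ℂ) (fourier (-(i : ℤ)) t)) * inner ℂ x y
        ∂haarC := by
        congr 1; ext t; ring
    _ = 0 := by rw [integral_mul_const, h2, zero_mul]

/-- the isometry from ℓ² -/
def Jemb : ellTwo H →ₗᵢ[ℂ] Lp H 2 haarC := Vorth.linearIsometry

lemma Jemb_single (j : ℕ) (x : H) : Jemb (lp.single 2 j x) = toL2 (tens x (fourier (-(j : ℤ)))) :=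
  Vorth.linearIsometry_apply_single x

/-- The Toeplitz operator -/
def toep : C(Circ, H →L[ℂ] H) →L[ℂ] (ellTwo H →L[ℂ] ellTwo H) :=
  (ContinuousLinearMap.compL ℂ (ellTwo H) (Lp H 2 haarC) (ellTwo H)
    (ContinuousLinearMap.adjoint (Jemb (H := H)).toContinuousLinearMap)) ∘L
  ((ContinuousLinearMap.compL ℂ (ellTwo H) (Lp H 2 haarC) (Lp H 2 haarC)).flip (Jemb (H := H)).toContinuousLinearMap) ∘L mulOp

lemma inner_toep (f : C(Circ, H →L[ℂ] H)) (u v : ellTwo H) :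
    inner ℂ u (toep f v) = inner ℂ (Jemb u) (mulOp f (Jemb v)) := by
  have : toep f v = ContinuousLinearMap.adjoint (Jemb (H := H)).toContinuousLinearMap
    (mulOp f (Jemb v)) := rfl
  rw [this, ContinuousLinearMap.adjoint_inner_right]; rfl

lemma norm_toep_le (f : C(Circ, H →L[ℂ] H)) : ‖toep f‖ ≤ ‖f‖ := by
  refine ContinuousLinearMap.opNorm_le_bound _ (norm_nonneg _) fun v => ?_
  have h : ‖toep f v‖ ^ 2 ≤ ‖toep f v‖ * (‖f‖ * ‖v‖) := by
    rw [← inner_self_eq_norm_sq (𝕜 := ℂ), inner_toep]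
    refine (RCLike.re_le_norm _).trans ((norm_inner_le_norm _ _).trans ?_)
    rw [LinearIsometry.norm_map]
    gcongr
    refine (ContinuousLinearMap.le_of_opNorm_le _ (norm_mulOp_le f) _).trans ?_
    rw [LinearIsometry.norm_map]
  rcases (norm_nonneg (toep f v)).eq_or_lt with h0 | h0
  · rw [← h0]; positivity
  · rw [sq] at h; exact le_of_mul_le_mul_left h h0

lemma toep_entry (f : C(Circ, H →L[ℂ] H)) :
    Represents (fun k j => fourierCoeff f ((j : ℤ) - k)) (toep f) := by
  intro j x k
  refine ext_inner_left ℂ fun (y : H) => ?_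
  have h0 : inner ℂ y (toep f (lp.single 2 j x) k) =
      inner ℂ (lp.single 2 k y : ellTwo H) (toep f (lp.single 2 j x)) :=
    (lp.inner_single_left (𝕜 := ℂ) (G := fun _ : ℕ => H) k y (toep f (lp.single 2 j x))).symm
  refine h0.trans ?_
  rw [inner_toep, Jemb_single, Jemb_single, inner_mulOp]
  have hint : Integrable (fun t => fourier (-((j : ℤ) - k)) t • f t) haarC := by
    refine Continuous.integrable_of_hasCompactSupport (by fun_prop) ?_
    exact HasCompactSupport.of_compactSpace _
  change _ = inner ℂ y (fourierCoeff f ((j : ℤ) - k) x)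
  rw [fourierCoeff, ContinuousLinearMap.integral_apply hint, ← integral_inner
    (hint.apply_continuousLinearMap x)]
  congr 1; ext t
  simp only [tens_apply, map_smul, inner_smul_left, inner_smul_right, ← fourier_neg, neg_neg,
    ContinuousLinearMap.smul_apply]
  rw [← mul_assoc, ← fourier_add]
  congr 3; ring

lemma toep_lower_aux (f : C(Circ, H →L[ℂ] H)) (x y : H) (φ : C(Circ, ℂ)) :
    ‖inner ℂ (toL2 (tens y φ)) (mulOp f (toL2 (tens x φ)))‖ ≤
      ‖toep f‖ * ‖toL2 (tens y φ)‖ * ‖toL2 (tens x φ)‖ := by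
  let S : Submodule ℂ C(Circ, ℂ) := Submodule.span ℂ (Set.range fun n : ℕ => fourier (-(n : ℤ)))
  have hS : ∀ ψ ∈ S, ∀ z : H, ∃ u : ellTwo H, Jemb u = toL2 (tens z ψ) := by
    intro ψ hψ z
    have : S ≤ (LinearMap.range (Jemb (H := H)).toLinearMap).comap
        (toL2 ∘L tens z).toLinearMap := by
      rw [Submodule.span_le]
      rintro _ ⟨n, rfl⟩
      exact ⟨lp.single 2 n z, Jemb_single n z⟩
    exact this hψ
  have hSP : ∀ ψ ∈ S, ‖inner ℂ (toL2 (tens y ψ)) (mulOp f (toL2 (tens x ψ)))‖ ≤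
      ‖toep f‖ * ‖toL2 (tens y ψ)‖ * ‖toL2 (tens x ψ)‖ := by
    intro ψ hψ
    obtain ⟨u, hu⟩ := hS ψ hψ y
    obtain ⟨v, hv⟩ := hS ψ hψ x
    rw [← hu, ← hv, ← inner_toep, LinearIsometry.norm_map, LinearIsometry.norm_map]
    refine (norm_inner_le_norm _ _).trans ?_
    calc _ ≤ ‖u‖ * (‖toep f‖ * ‖v‖) := by gcongr; exact ContinuousLinearMap.le_opNorm _ _
      _ = _ := by ring
  have hshift : ∀ ψ ∈ Submodule.span ℂ (Set.range (@fourier (2 * Real.pi))),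
      ∃ N₀ : ℕ, ∀ N ≥ N₀, fourier (-(N : ℤ)) * ψ ∈ S := by
    intro ψ hψ
    induction hψ using Submodule.span_induction with
    | mem ψ h =>
      obtain ⟨n, rfl⟩ := h
      refine ⟨n.toNat, fun N hN => Submodule.subset_span ⟨(N - n).toNat, ?_⟩⟩
      ext t
      rw [ContinuousMap.mul_apply, ← fourier_add]
      have : -(((N - n).toNat : ℕ) : ℤ) = -(N : ℤ) + n := by omega
      simp only [this]
    | zero => exact ⟨0, fun N _ => by simp⟩
    | add a b _ _ ha hb =>
      obtain ⟨N1, h1⟩ := ha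
      obtain ⟨N2, h2⟩ := hb
      refine ⟨max N1 N2, fun N hN => ?_⟩
      rw [mul_add]
      exact S.add_mem (h1 N (le_trans (le_max_left _ _) hN)) (h2 N (le_trans (le_max_right _ _) hN))
    | smul c a _ ha =>
      obtain ⟨N1, h1⟩ := ha
      refine ⟨N1, fun N hN => ?_⟩
      rw [mul_smul_comm]
      exact S.smul_mem _ (h1 N hN)
  have hnorm : ∀ (N : ℤ) (ψ : C(Circ, ℂ)) (t : Circ), ‖(fourier N * ψ : C(Circ, ℂ)) t‖ = ‖ψ t‖ := by
    intro N ψ t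
    have h1 : ‖fourier N t‖ = 1 := Circle.norm_coe _
    rw [ContinuousMap.mul_apply, norm_mul, h1, one_mul]
  have hnorm2 : ∀ (N : ℤ) (ψ : C(Circ, ℂ)) (z : H),
      ‖toL2 (tens z (fourier N * ψ))‖ = ‖toL2 (tens z ψ)‖ := by
    intro N ψ z
    rw [← sq_eq_sq₀ (norm_nonneg _) (norm_nonneg _), norm_toL2_tens_sq, norm_toL2_tens_sq]
    simp only [hnorm]
  have hspan : ∀ ψ ∈ Submodule.span ℂ (Set.range (@fourier (2 * Real.pi))),
      ‖inner ℂ (toL2 (tens y ψ)) (mulOp f (toL2 (tens x ψ)))‖ ≤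
      ‖toep f‖ * ‖toL2 (tens y ψ)‖ * ‖toL2 (tens x ψ)‖ := by
    intro ψ hψ
    obtain ⟨N, hN⟩ := hshift ψ hψ
    have := hSP _ (hN N le_rfl)
    rw [hnorm2, hnorm2, inner_tens] at this
    simp only [hnorm] at this
    rwa [← inner_tens] at this
  have hmem : φ ∈ closure (Submodule.span ℂ (Set.range (@fourier (2 * Real.pi))) :
      Set C(Circ, ℂ)) := by
    rw [← Submodule.topologicalClosure_coe, span_fourier_closure_eq_top]; trivial
  have hclosed : IsClosed {ψ : C(Circ, ℂ) |
      ‖inner ℂ (toL2 (tens y ψ)) (mulOp f (toL2 (tens x ψ)))‖ ≤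
      ‖toep f‖ * ‖toL2 (tens y ψ)‖ * ‖toL2 (tens x ψ)‖} := by
    refine isClosed_le ?_ ?_
    · exact (Continuous.inner (by fun_prop) (by fun_prop)).norm
    · fun_prop
  exact closure_minimal hspan hclosed hmem

lemma toep_lower (f : C(Circ, H →L[ℂ] H)) : ‖f‖ ≤ ‖toep f‖ := by
  rw [ContinuousMap.norm_le _ (norm_nonneg _)]
  intro t₀
  refine ContinuousLinearMap.opNorm_le_bound _ (norm_nonneg _) fun x => ?_
  set y := f t₀ x with hy
  set D := ‖toep f‖ * ‖y‖ * ‖x‖ with hD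
  have hgc : Continuous fun t => (inner ℂ y (f t x)).re := by
    exact Complex.continuous_re.comp (Continuous.inner (by fun_prop) (by fun_prop))
  let r : C(Circ, ℝ) := ⟨fun t => max 0 ((inner ℂ y (f t x)).re - D), by fun_prop⟩
  let φ : C(Circ, ℂ) := ⟨fun t => (r t : ℂ), by fun_prop⟩
  have hφ : ∀ t, ‖φ t‖ = r t := fun t => by
    change ‖(r t : ℂ)‖ = _
    have h : 0 ≤ r t := le_max_left _ _
    rw [Complex.norm_real, Real.norm_of_nonneg h]
  have hi : ∀ {E : Type} [NormedAddCommGroup E] {g : Circ → E}, Continuous g →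
      Integrable g haarC := fun hg =>
    hg.integrable_of_hasCompactSupport (HasCompactSupport.of_compactSpace _)
  have key := toep_lower_aux f x y φ
  have hn : ∀ z : H, ‖toL2 (tens z φ)‖ = √(∫ t, r t ^ 2 ∂haarC) * ‖z‖ := by
    intro z
    rw [← sq_eq_sq₀ (norm_nonneg _) (by positivity), norm_toL2_tens_sq, mul_pow, Real.sq_sqrt]
    · simp only [hφ]
    · positivity
  rw [hn, hn, inner_tens] at key
  simp only [hφ] at key
  have hss : √(∫ t, r t ^ 2 ∂haarC) * √(∫ t, r t ^ 2 ∂haarC) = ∫ t, r t ^ 2 ∂haarC :=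
    Real.mul_self_sqrt (by positivity)
  have key2 : ∫ t, r t ^ 2 * (inner ℂ y (f t x)).re ∂haarC ≤ D * ∫ t, r t ^ 2 ∂haarC := by
    have hcc : Continuous fun t => ((r t ^ 2 : ℝ) : ℂ) * inner ℂ y (f t x) := by
      refine Continuous.mul (by fun_prop) (Continuous.inner (by fun_prop) (by fun_prop))
    have h1 : ∫ t, r t ^ 2 * (inner ℂ y (f t x)).re ∂haarC =
        (∫ t, ((r t ^ 2 : ℝ) : ℂ) * inner ℂ y (f t x) ∂haarC).re := by
      have := integral_re (𝕜 := ℂ) (hi hcc)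
      simp only [RCLike.re_eq_complex_re, Complex.re_ofReal_mul] at this
      exact this
    rw [h1]
    refine (Complex.re_le_norm _).trans (key.trans_eq ?_)
    rw [hD]
    linear_combination (‖toep f‖ * ‖y‖ * ‖x‖) * hss
  have key3 : ∫ t, r t ^ 3 ∂haarC ≤ 0 := by
    have : ∀ t, r t ^ 3 = r t ^ 2 * (inner ℂ y (f t x)).re - D * r t ^ 2 := by
      intro t
      have h : r t = max 0 ((inner ℂ y (f t x)).re - D) := rfl
      rcases le_total ((inner ℂ y (f t x)).re - D) 0 with h' | h'
      · rw [max_eq_left h'] at h; simp [h]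
      · rw [max_eq_right h'] at h
        rw [pow_succ]; nth_rewrite 2 [h]; ring
    simp only [this]
    rw [integral_sub (hi (by fun_prop)) (hi (by fun_prop)), integral_const_mul]
    linarith
  by_contra! hlt
  have hpos : 0 < r t₀ := by
    refine lt_max_of_lt_right ?_
    have h1 : (inner ℂ y (f t₀ x)).re = ‖y‖ ^ 2 := by
      rw [← hy]; exact inner_self_eq_norm_sq (𝕜 := ℂ) y
    have h2 : 0 < ‖y‖ := lt_of_le_of_lt (by positivity) hlt
    rw [h1, hD]
    nlinarith
  have := haarC_openPos
  have h0 : 0 < ∫ t, r t ^ 3 ∂haarC := by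
    refine Continuous.integral_pos_of_hasCompactSupport_nonneg_nonzero (x := t₀) (by fun_prop)
      (HasCompactSupport.of_compactSpace _) (fun t => pow_nonneg (le_max_left _ _) 3) ?_
    exact (pow_pos hpos 3).ne'
  linarith

/-- the submodule of operators given by polynomial matrices -/
def polySub : Submodule ℂ (ellTwo H →L[ℂ] ellTwo H) where
  carrier := {B | ∃ T, PolyMat T ∧ Represents T B}
  zero_mem' := ⟨0, ⟨⟨0, fun _ _ _ => rfl⟩, 0, fun _ _ => by simp⟩, fun _ _ _ => by simp⟩
  add_mem' := by
    rintro A B ⟨S, ⟨⟨N, hN⟩, M, hM⟩, hS⟩ ⟨T, ⟨⟨N', hN'⟩, M', hM'⟩, hT⟩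
    refine ⟨S + T, ⟨⟨max N N', fun k j h => ?_⟩, M + M', fun k j => ?_⟩, fun j x k => ?_⟩
    · simp [hN k j (by push_cast at h; omega), hN' k j (by push_cast at h; omega)]
    · exact (norm_add_le _ _).trans (add_le_add (hM k j) (hM' k j))
    · simp [hS j x k, hT j x k]
  smul_mem' := by
    rintro c A ⟨S, ⟨⟨N, hN⟩, M, hM⟩, hS⟩
    refine ⟨c • S, ⟨⟨N, fun k j h => ?_⟩, ‖c‖ * M, fun k j => ?_⟩, fun j x k => ?_⟩
    · simp [hN k j h]
    · simp only [Pi.smul_apply, norm_smul]; gcongr; exact hM k j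
    · simp [hS j x k]

lemma fourierCoeff_tens (n l : ℤ) (T : H →L[ℂ] H) :
    fourierCoeff (tens T (fourier n)) l = if l = n then T else 0 := by
  have h := fourierCoeff_fourier (T := 2 * Real.pi) n
  have h2 : fourierCoeff (tens T (fourier n)) l =
      fourierCoeff (fourier n : C(Circ, ℂ)) l • T := by
    rw [fourierCoeff, fourierCoeff, ← integral_smul_const]
    simp [smul_smul]
  rw [h2, h]
  by_cases hl : l = n <;> simp [hl, Pi.single_apply]

lemma toep_tens_mem (φ : C(Circ, ℂ)) (T : H →L[ℂ] H) :
    toep (tens T φ) ∈ (polySub (H := H)).topologicalClosure := by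
  have hcont : Continuous fun φ : C(Circ, ℂ) => toep (tens T φ) :=
    (toep (H := H)).continuous.comp (tens T).continuous
  have hc : IsClosed {φ : C(Circ, ℂ) | toep (tens T φ) ∈ (polySub (H := H)).topologicalClosure} :=
    (Submodule.isClosed_topologicalClosure _).preimage hcont
  have hs : Submodule.span ℂ (Set.range (@fourier (2 * Real.pi))) ≤
      ((polySub (H := H)).topologicalClosure).comap
        ((toep (H := H)).toLinearMap ∘ₗ (tens T).toLinearMap) := by
    rw [Submodule.span_le]
    rintro _ ⟨n, rfl⟩
    refine Submodule.le_topologicalClosure _ ⟨fun k j =>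
      fourierCoeff (tens T (fourier n)) ((j : ℤ) - k), ?_, toep_entry (tens T (fourier n))⟩
    have he : (fun k j : ℕ => fourierCoeff (tens T (fourier n)) ((j : ℤ) - k)) =
        fun k j : ℕ => if (j : ℤ) - k = n then T else 0 := by
      funext k j; exact fourierCoeff_tens _ _ _
    rw [he]
    refine ⟨⟨n.natAbs, fun k j h => ?_⟩, ‖T‖, fun k j => ?_⟩
    · refine if_neg fun h' => ?_
      rw [h', Int.abs_eq_natAbs] at h
      exact lt_irrefl _ h
    · dsimp only; split_ifs <;> simp
  have hmem : φ ∈ closure (Submodule.span ℂ (Set.range (@fourier (2 * Real.pi))) :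
      Set C(Circ, ℂ)) := by
    rw [← Submodule.topologicalClosure_coe, span_fourier_closure_eq_top]; trivial
  exact closure_minimal hs hc hmem

lemma toep_mem (f : C(Circ, H →L[ℂ] H)) :
    toep f ∈ (polySub (H := H)).topologicalClosure := by
  have hc : IsClosed {f : C(Circ, H →L[ℂ] H) |
      toep f ∈ (polySub (H := H)).topologicalClosure} :=
    (Submodule.isClosed_topologicalClosure _).preimage toep.continuous
  change f ∈ {f : C(Circ, H →L[ℂ] H) | toep f ∈ (polySub (H := H)).topologicalClosure}
  rw [← hc.closure_eq, Metric.mem_closure_iff]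
  intro ε hε
  -- finite cover
  have ho : ∀ s : Circ, IsOpen {t | dist (f t) (f s) < ε / 2} := fun s =>
    isOpen_lt (by fun_prop) continuous_const
  obtain ⟨I, hI⟩ := isCompact_univ.elim_finite_subcover (fun s : Circ =>
    {t | dist (f t) (f s) < ε / 2}) ho (fun t _ => Set.mem_iUnion.2 ⟨t, by simp [hε]⟩)
  let e := I.equivFin
  have hcov : (Set.univ : Set Circ) ⊆
      ⋃ i : Fin I.card, {t | dist (f t) (f (e.symm i : Circ)) < ε / 2} := by
    intro t ht
    obtain ⟨s, hs, hts⟩ := Set.mem_iUnion₂.1 (hI ht)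
    exact Set.mem_iUnion.2 ⟨e ⟨s, hs⟩, by simpa using hts⟩
  obtain ⟨ρ, h1, h2, h3, -⟩ := exists_continuous_sum_one_of_isOpen_isCompact
    (fun i => ho (e.symm i : Circ)) isCompact_univ hcov
  let φ : Fin I.card → C(Circ, ℂ) := fun i => ⟨fun t => (ρ i t : ℂ), by fun_prop⟩
  refine ⟨∑ i, tens (f (e.symm i : Circ)) (φ i), ?_, ?_⟩
  · change toep (∑ i, tens (f (e.symm i : Circ)) (φ i)) ∈ (polySub (H := H)).topologicalClosure
    rw [map_sum]
    exact Submodule.sum_mem _ fun i _ => toep_tens_mem _ _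
  refine lt_of_le_of_lt ?_ (half_lt_self hε)
  rw [dist_eq_norm, ContinuousMap.norm_le _ (by positivity)]
  intro t
  have hsum : ∑ i, ρ i t = 1 := by
    have := h2 (Set.mem_univ t); simpa using this
  have hsum' : f t = ∑ i, ρ i t • f t := by rw [← Finset.sum_smul, hsum, one_smul]
  have heq : (f - ∑ i, tens (f (e.symm i : Circ)) (φ i)) t =
      ∑ i, ρ i t • (f t - f (e.symm i : Circ)) := by
    simp only [smul_sub, Finset.sum_sub_distrib, ← hsum', ContinuousMap.sub_apply,
      ContinuousMap.sum_apply, tens_apply]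
    congr 1
  rw [heq]
  calc _ ≤ ∑ i, ρ i t * (ε / 2) := by
        refine norm_sum_le_of_le _ fun i _ => ?_
        rw [norm_smul, Real.norm_of_nonneg (h3 i t).1]
        by_cases h0 : ρ i t = 0
        · simp [h0]
        · have : dist (f t) (f (e.symm i : Circ)) < ε / 2 := h1 i (subset_tsupport _ h0)
          rw [dist_eq_norm] at this
          exact mul_le_mul_of_nonneg_left this.le (h3 i t).1
    _ = ε / 2 := by rw [← Finset.sum_mul, hsum, one_mul]

/-- for `f ∈ C(𝕋, B(H))`, the Toeplitz matrix `A_f = (f̂(j−k))` defines a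
bounded operator on `ℓ²(H)` lying in `𝒞(ℓ²(H))`, with `‖A_f‖ = sup_t ‖f(t)‖`. -/
theorem toeplitz_of_continuous_function (f : ℝ → (H →L[ℂ] H))
    (hc : Continuous f) (hp : Function.Periodic f (2 * Real.pi)) :
    ∃ A : ellTwo H →L[ℂ] ellTwo H,
      Represents (fun k j => opFourierCoeff f ((j : ℤ) - (k : ℤ))) A ∧
      ContinuousClass A ∧ ‖A‖ = ⨆ t : ℝ, ‖f t‖ := by
  let F : C(Circ, H →L[ℂ] H) := ⟨hp.lift, continuous_coinduced_dom.mpr hc⟩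
  have hF : ∀ t : ℝ, F (t : Circ) = f t := fun t => hp.lift_coe t
  have hcoef : ∀ l : ℤ, opFourierCoeff f l = fourierCoeff F l := by
    intro l
    rw [fourierCoeff_eq_intervalIntegral _ _ 0, opFourierCoeff, zero_add]
    congr 1
    refine intervalIntegral.integral_congr fun t _ => ?_
    simp only [hF, fourier_coe_apply]
    congr 2
    have : (Real.pi : ℂ) ≠ 0 := by exact_mod_cast Real.pi_ne_zero
    push_cast
    field_simp
  refine ⟨toep F, ?_, toep_mem F, ?_⟩
  · simp only [hcoef]; exact toep_entry F
  · rw [le_antisymm (norm_toep_le F) (toep_lower F)]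
    have hbd : BddAbove (Set.range fun t : ℝ => ‖f t‖) := by
      refine ⟨‖F‖, ?_⟩
      rintro _ ⟨t, rfl⟩
      simp only [← hF]; exact F.norm_coe_le_norm _
    refine le_antisymm ?_ (ciSup_le fun t => by rw [← hF]; exact F.norm_coe_le_norm _)
    rw [ContinuousMap.norm_le _ (le_ciSup_of_le hbd 0 (norm_nonneg _))]
    intro t
    obtain ⟨s, rfl⟩ := QuotientAddGroup.mk_surjective t
    have := le_ciSup hbd s
    simp only [← hF] at this
    simpa only [← hF] using this
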